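/- Let d ≥ 1. There is a constant C(d) > 0 with the following property: for every finite simple graph Γ with N ≥ 1 vertices and maximum degree at most d, regarded as a 1-dimensional simplicial complex, there exists a topological embedding I of the polyhedron |Γ| into the closed ball of radius C(d)·N^{1/2} in ℝ³ such that I has combinatorial thickness at least 1. -/

import Mathlib

open scoped Classical
open Metric Set Function

/-- An embedding `I` of the polyhedron of a geometric simplicial complex `X` has
combinatorial thickness at least `T` if the images of the convex hulls of any two
disjoint faces are at Euclidean distance at least `T` from each other. -/
def HasCombThickness {E F : Type*} [NormedAddCommGroup E] [NormedSpace ℝ E]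
    [NormedAddCommGroup F] [NormedSpace ℝ F]
    (X : Geometry.SimplicialComplex ℝ E) (I : X.space → F) (T : ℝ) : Prop :=
  ∀ s ∈ X.faces, ∀ t ∈ X.faces, Disjoint s t →
    ∀ x y : X.space, (x : E) ∈ convexHull ℝ (s : Set E) →
      (y : E) ∈ convexHull ℝ (t : Set E) → T ≤ dist (I x) (I y)

/-- A geometric simplicial complex `K` (together with a vertex map `f`) is a realization
of the simple graph `G`, regarded as a 1-dimensional simplicial complex: the faces of `K`
are exactly the vertices and the edges of `G`. -/
def IsGraphRealization {V E : Type*} [NormedAddCommGroup E] [NormedSpace ℝ E]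
    (G : SimpleGraph V) (K : Geometry.SimplicialComplex ℝ E) (f : V → E) : Prop :=
  Function.Injective f ∧
    K.faces = {s : Finset E | (∃ v : V, s = {f v}) ∨ ∃ u v : V, G.Adj u v ∧ s = {f u, f v}}

lemma greedy_col {α : Type*} [Fintype α] (r : α → α → Prop) (D : ℕ)
    (hs : ∀ a b, r a b → r b a)
    (h : ∀ a, (Finset.univ.filter (fun b => r a b)).card ≤ D) :
    ∃ k : α → ℕ, (∀ a, k a ≤ D) ∧ ∀ a b, a ≠ b → r a b → k a ≠ k b := by
  have key : ∀ S : Finset α, ∃ k : α → ℕ, (∀ a, k a ≤ D) ∧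
      ∀ a ∈ S, ∀ b ∈ S, a ≠ b → r a b → k a ≠ k b := by
    intro S
    induction S using Finset.induction_on with
    | empty => exact ⟨fun _ => 0, by simp, by simp⟩
    | insert a S ha ih =>
      obtain ⟨k, hk, hk2⟩ := ih
      have : ∃ c ∈ Finset.range (D + 1),
          c ∉ (Finset.univ.filter (fun b => r a b)).image k := by
        apply Finset.exists_mem_notMem_of_card_lt_card
        rw [Finset.card_range]
        exact Nat.lt_succ_of_le (Finset.card_image_le.trans (h a))
      obtain ⟨c, hc, hc2⟩ := this
      have hc3 : ∀ b, r a b → c ≠ k b := by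
        intro b hb he
        apply hc2
        simp only [Finset.mem_image, Finset.mem_filter, Finset.mem_univ, true_and]
        exact ⟨b, hb, he.symm⟩
      refine ⟨fun b => if b = a then c else k b, ?_, ?_⟩
      · intro b
        dsimp only
        split_ifs
        · simpa [Nat.lt_succ_iff] using hc
        · exact hk b
      · intro x hx y hy hxy hr
        dsimp only
        rw [Finset.mem_insert] at hx hy
        split_ifs with h1 h2 h2
        · exact absurd (h1.trans h2.symm) hxy
        · subst h1; exact hc3 y hr
        · subst h2; exact (hc3 x (hs _ _ hr)).symm
        · exact hk2 x (hx.resolve_left h1) y (hy.resolve_left h2) hxy hr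
  obtain ⟨k, hk, hk2⟩ := key Finset.univ
  exact ⟨k, hk, fun a b => hk2 a (Finset.mem_univ _) b (Finset.mem_univ _)⟩

section glue

variable {V E F : Type*} [NormedAddCommGroup E] [NormedSpace ℝ E]
    [NormedAddCommGroup F] [NormedSpace ℝ F]

lemma seg_param {a b x : E} (hab : a ≠ b) (hx : x ∈ segment ℝ a b) :
    dist x a / dist a b ∈ Set.Icc (0:ℝ) 1 ∧
      AffineMap.lineMap a b (dist x a / dist a b) = x := by
  rw [segment_eq_image_lineMap] at hx
  obtain ⟨t, ht, rfl⟩ := hx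
  have : dist a b ≠ 0 := dist_ne_zero.mpr hab
  rw [dist_lineMap_left, Real.norm_of_nonneg ht.1, mul_div_assoc, div_self this, mul_one]
  exact ⟨ht, rfl⟩

theorem glue_emb [Finite V] (G : SimpleGraph V) (K : Geometry.SimplicialComplex ℝ E) (f : V → E)
    (hK : IsGraphRealization G K f)
    (O : V → V → Prop) (hO1 : ∀ u v, O u v → G.Adj u v)
    (hO2 : ∀ u v, G.Adj u v → O u v ∨ O v u) (hO3 : ∀ u v, O u v → ¬ O v u)
    (p : V → F) (γ : V → V → ℝ → F) (hc : ∀ u v, Continuous (γ u v))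
    (h0 : ∀ u v, γ u v 0 = p u) (h1 : ∀ u v, γ u v 1 = p v)
    (hp : Function.Injective p)
    (h2 : ∀ u v, O u v → ∀ t ∈ Set.Ioo (0:ℝ) 1, ∀ w, γ u v t ≠ p w)
    (h3 : ∀ u v, O u v → ∀ u' v', O u' v' → ∀ s ∈ Set.Ioo (0:ℝ) 1, ∀ t ∈ Set.Ioo (0:ℝ) 1,
      γ u v s = γ u' v' t → u = u' ∧ v = v' ∧ s = t)
    (R : ℝ) (hb : ∀ u v, O u v → ∀ t ∈ Set.Icc (0:ℝ) 1, ‖γ u v t‖ ≤ R)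
    (hbp : ∀ v, ‖p v‖ ≤ R)
    (t1 : ∀ u v, u ≠ v → 1 ≤ dist (p u) (p v))
    (t2 : ∀ u v, O u v → ∀ w, w ≠ u → w ≠ v → ∀ t ∈ Set.Icc (0:ℝ) 1, 1 ≤ dist (p w) (γ u v t))
    (t3 : ∀ u v, O u v → ∀ u' v', O u' v' → u ≠ u' → u ≠ v' → v ≠ u' → v ≠ v' →
      ∀ s ∈ Set.Icc (0:ℝ) 1, ∀ t ∈ Set.Icc (0:ℝ) 1, 1 ≤ dist (γ u v s) (γ u' v' t)) :
    ∃ I : K.space → F, Continuous I ∧ Function.Injective I ∧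
      (∀ x, I x ∈ Metric.closedBall (0 : F) R) ∧ HasCombThickness K I 1 := by
  obtain ⟨hf, hfaces⟩ := hK
  have fV : ∀ v, ({f v} : Finset E) ∈ K.faces := by
    intro v; rw [hfaces]; exact Or.inl ⟨v, rfl⟩
  have fE : ∀ u v, O u v → ({f u, f v} : Finset E) ∈ K.faces := by
    intro u v h; rw [hfaces]; exact Or.inr ⟨u, v, hO1 u v h, rfl⟩
  have hne : ∀ u v, O u v → f u ≠ f v := fun u v h e => (hO1 u v h).ne (hf e)
  have faces_cases : ∀ s ∈ K.faces, (∃ v, s = {f v}) ∨ ∃ u v, O u v ∧ s = {f u, f v} := by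
    intro s hs
    rw [hfaces] at hs
    rcases hs with ⟨v, hv⟩ | ⟨u, v, ha, hs⟩
    · exact Or.inl ⟨v, hv⟩
    · rcases hO2 u v ha with h | h
      · exact Or.inr ⟨u, v, h, hs⟩
      · exact Or.inr ⟨v, u, h, by rw [hs, Finset.pair_comm]⟩
  -- vertices on edges
  have vert_edge : ∀ u v w, O u v → f w ∈ segment ℝ (f u) (f v) → w = u ∨ w = v := by
    intro u v w h hw
    have := K.inter_subset_convexHull (fV w) (fE u v h)
      (show f w ∈ _ from ⟨by simp, by simpa [convexHull_pair] using hw⟩)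
    have hn : ((({f w} : Finset E) : Set E) ∩ (({f u, f v} : Finset E) : Set E)).Nonempty := by
      rw [← convexHull_nonempty_iff (𝕜 := ℝ)]; exact ⟨_, this⟩
    obtain ⟨z, hz1, hz2⟩ := hn
    simp at hz1 hz2
    subst hz1
    exact hz2.imp (fun h => hf h) (fun h => hf h)
  have edge_edge : ∀ u v u' v' x, O u v → O u' v' → x ∈ segment ℝ (f u) (f v) →
      x ∈ segment ℝ (f u') (f v') → (∀ w, f w ≠ x) → u = u' ∧ v = v' := by
    intro u v u' v' x h h' hx hx' hw
    have := K.inter_subset_convexHull (fE u v h) (fE u' v' h')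
      (show x ∈ _ from ⟨by simpa [convexHull_pair] using hx,
        by simpa [convexHull_pair] using hx'⟩)
    have huv := hne u v h
    have huv' := hne u' v' h'
    by_contra hcon
    have hsub : ∃ w, ((({f u, f v} : Finset E) : Set E) ∩ (({f u', f v'} : Finset E) : Set E))
        ⊆ {f w} := by
      by_cases hu : u = u' ∨ u = v'
      · refine ⟨u, ?_⟩
        rintro z ⟨hz1, hz2⟩
        simp at hz1 hz2 ⊢
        rcases hz1 with hz1 | hz1
        · exact hz1
        · exfalso
          rcases hz2 with hz2 | hz2
          · have e1 : v = u' := hf (hz1.symm.trans hz2)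
            rcases hu with e2 | e2
            · exact huv (by rw [e1, e2])
            · subst e1 e2; exact hO3 _ _ h h'
          · have e1 : v = v' := hf (hz1.symm.trans hz2)
            rcases hu with e2 | e2
            · exact hcon ⟨e2, e1⟩
            · exact huv (by rw [e1, e2])
      · refine ⟨v, ?_⟩
        rintro z ⟨hz1, hz2⟩
        simp at hz1 hz2 ⊢
        rcases hz1 with hz1 | hz1
        · exfalso
          apply hu
          exact hz2.imp (fun e => hf (hz1.symm.trans e)) (fun e => hf (hz1.symm.trans e))
        · exact hz1
    obtain ⟨w, hsub⟩ := hsub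
    have := convexHull_mono (𝕜 := ℝ) hsub this
    rw [convexHull_singleton] at this
    exact hw w this.symm
  let τ : V → V → E → ℝ := fun u v x => dist x (f u) / dist (f u) (f v)
  let J : E → F := fun x => if h : ∃ v, f v = x then p h.choose else
    if h : ∃ q : V × V, O q.1 q.2 ∧ x ∈ segment ℝ (f q.1) (f q.2) then
      γ h.choose.1 h.choose.2 (τ h.choose.1 h.choose.2 x) else 0
  have Jv : ∀ v, J (f v) = p v := by
    intro v
    have h : ∃ w, f w = f v := ⟨v, rfl⟩
    simp only [J, dif_pos h]
    rw [hf h.choose_spec]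
  have Je : ∀ u v x, O u v → x ∈ segment ℝ (f u) (f v) → J x = γ u v (τ u v x) := by
    intro u v x h hx
    by_cases hw : ∃ w, f w = x
    · obtain ⟨w, rfl⟩ := hw
      rw [Jv]
      rcases vert_edge u v w h hx with rfl | rfl
      · simp [τ, h0]
      · have : dist (f u) (f w) ≠ 0 := dist_ne_zero.mpr (hne _ _ h)
        simp only [τ]
        rw [dist_comm (f w), div_self this, h1]
    · have h' : ∃ q : V × V, O q.1 q.2 ∧ x ∈ segment ℝ (f q.1) (f q.2) := ⟨(u, v), h, hx⟩
      simp only [J, dif_neg hw, dif_pos h']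
      obtain ⟨e1, e2⟩ := edge_edge _ _ _ _ x h'.choose_spec.1 h h'.choose_spec.2 hx
        (fun w hw' => hw ⟨w, hw'⟩)
      rw [e1, e2]
  have cases : ∀ x ∈ K.space, (∃ v, x = f v) ∨ ∃ u v, O u v ∧ x ∈ segment ℝ (f u) (f v) ∧
      τ u v x ∈ Set.Ioo (0:ℝ) 1 := by
    intro x hx
    rw [Geometry.SimplicialComplex.mem_space_iff] at hx
    obtain ⟨s, hs, hx⟩ := hx
    rcases faces_cases s hs with ⟨v, rfl⟩ | ⟨u, v, h, rfl⟩
    · left; exact ⟨v, by simpa using hx⟩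
    · have hx : x ∈ segment ℝ (f u) (f v) := by simpa [convexHull_pair] using hx
      obtain ⟨ht, hl⟩ := seg_param (hne u v h) hx
      rcases ht.1.eq_or_lt with h' | h'
      · left; refine ⟨u, ?_⟩; rw [← hl, ← h']; simp
      rcases ht.2.eq_or_lt with h'' | h''
      · left; refine ⟨v, ?_⟩; rw [← hl, h'']; simp
      right; exact ⟨u, v, h, hx, h', h''⟩
  refine ⟨fun x => J x, ?_, ?_, ?_, ?_⟩
  · let A : V ⊕ {q : V × V // O q.1 q.2} → Set E := fun i =>
      Sum.elim (fun v => {f v}) (fun q => segment ℝ (f q.1.1) (f q.1.2)) i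
    have hA : ∀ i, IsClosed (A i) := by
      rintro (v | q)
      · exact isClosed_singleton
      · simp only [A, Sum.elim_inr]
        rw [← convexHull_pair (𝕜 := ℝ)]
        exact ((Set.toFinite _).isCompact_convexHull ℝ).isClosed
    have hAc : ∀ i, ContinuousOn J (A i) := by
      rintro (v | q)
      · exact continuousOn_singleton _ _
      · simp only [A, Sum.elim_inr]
        refine ContinuousOn.congr (f := fun x => γ q.1.1 q.1.2 (τ q.1.1 q.1.2 x)) ?_ ?_
        · apply Continuous.continuousOn
          apply (hc _ _).comp
          exact (continuous_id.dist continuous_const).div_const _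
        · intro x hx; exact Je _ _ x q.2 hx
    have hU : ContinuousOn J (⋃ i, A i) :=
      (locallyFinite_of_finite A).continuousOn_iUnion hA (fun i => hAc i)
    have hsub : K.space ⊆ ⋃ i, A i := by
      intro x hx
      rw [Set.mem_iUnion]
      rcases cases x hx with ⟨v, rfl⟩ | ⟨u, v, h, hx, -⟩
      · exact ⟨Sum.inl v, rfl⟩
      · exact ⟨Sum.inr ⟨(u, v), h⟩, hx⟩
    exact (hU.mono hsub).domRestrict
  · rintro ⟨x, hx⟩ ⟨y, hy⟩ hxy
    simp only at hxy
    apply Subtype.ext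
    change x = y
    rcases cases x hx with ⟨v, rfl⟩ | ⟨u, v, h, hx', ht⟩ <;>
    rcases cases y hy with ⟨v', rfl⟩ | ⟨u', v', h', hy', ht'⟩
    · rw [Jv, Jv] at hxy; rw [hp hxy]
    · rw [Jv, Je _ _ _ h' hy'] at hxy
      exact absurd hxy.symm (h2 _ _ h' _ ht' _)
    · rw [Jv, Je _ _ _ h hx'] at hxy
      exact absurd hxy (h2 _ _ h _ ht _)
    · rw [Je _ _ _ h hx', Je _ _ _ h' hy'] at hxy
      obtain ⟨rfl, rfl, e⟩ := h3 _ _ h _ _ h' _ ht _ ht' hxy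
      rw [← (seg_param (hne _ _ h) hx').2, ← (seg_param (hne _ _ h) hy').2]
      exact congrArg _ e
  · rintro ⟨x, hx⟩
    rw [mem_closedBall_zero_iff]
    rcases cases x hx with ⟨v, rfl⟩ | ⟨u, v, h, hx', ht⟩
    · simp only [Jv]; exact hbp v
    · simp only [Je _ _ _ h hx']; exact hb _ _ h _ ⟨ht.1.le, ht.2.le⟩
  · rintro s hs t ht hd ⟨x, hx⟩ ⟨y, hy⟩ hxs hyt
    simp only at hxs hyt ⊢
    rcases faces_cases s hs with ⟨v, rfl⟩ | ⟨u, v, h, rfl⟩ <;>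
    rcases faces_cases t ht with ⟨v', rfl⟩ | ⟨u', v', h', rfl⟩
    · simp at hxs hyt
      subst hxs hyt
      rw [Jv, Jv]
      apply t1
      rintro rfl
      simp at hd
    · simp [convexHull_pair] at hxs hyt
      subst hxs
      rw [Jv, Je _ _ _ h' hyt]
      refine t2 _ _ h' _ ?_ ?_ _ (seg_param (hne _ _ h') hyt).1
      · rintro rfl; simp at hd
      · rintro rfl; simp at hd
    · simp [convexHull_pair] at hxs hyt
      subst hyt
      rw [Jv, Je _ _ _ h hxs, dist_comm]
      refine t2 _ _ h _ ?_ ?_ _ (seg_param (hne _ _ h) hxs).1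
      · rintro rfl; simp at hd
      · rintro rfl; simp at hd
    · simp [convexHull_pair] at hxs hyt
      rw [Je _ _ _ h hxs, Je _ _ _ h' hyt]
      refine t3 _ _ h _ _ h' ?_ ?_ ?_ ?_ _ (seg_param (hne _ _ h) hxs).1 _
        (seg_param (hne _ _ h') hyt).1
      all_goals rintro rfl; simp at hd

end glue

noncomputable def clp (s : ℝ) : ℝ := max 0 (min 1 s)

lemma clp_zero {s : ℝ} (h : s ≤ 0) : clp s = 0 := by
  unfold clp; rw [max_eq_left]; exact (min_le_right _ _).trans h

lemma clp_one {s : ℝ} (h : 1 ≤ s) : clp s = 1 := by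
  unfold clp; rw [min_eq_left h]; simp

lemma clp_mid {s : ℝ} (h : 0 ≤ s) (h' : s ≤ 1) : clp s = s := by
  unfold clp; rw [min_eq_right h', max_eq_right h]

lemma clp_cont : Continuous clp := by unfold clp; fun_prop

noncomputable def pX (a a' : ℤ) (t : ℝ) : ℝ :=
  3 * a + clp t + (3 * a' + 1 - 3 * a) * clp (t - 2) - clp (t - 5) - clp (t - 6)

noncomputable def pY (b b' : ℤ) (t : ℝ) : ℝ :=
  3 * b + clp (t - 1) + (3 * b' - 3 * b - 1) * clp (t - 4)

noncomputable def pZ (k : ℤ) (t : ℝ) : ℝ :=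
  (2 * k + 2) * clp t + clp (t - 3) - (2 * k + 3) * clp (t - 6)

/-- Piecewise description of the path. -/
def Pcs (a b a' b' k : ℤ) (t x y z : ℝ) : Prop :=
  (∃ s, 0 ≤ s ∧ s ≤ 1 ∧ t = s ∧ x = 3 * a + s ∧ y = 3 * b ∧ z = (2 * k + 2) * s) ∨
  (∃ s, 0 ≤ s ∧ s ≤ 1 ∧ t = s + 1 ∧ x = 3 * a + 1 ∧ y = 3 * b + s ∧ z = 2 * k + 2) ∨
  (∃ s, 0 ≤ s ∧ s ≤ 1 ∧ t = s + 2 ∧ x = 3 * a + 1 + (3 * a' + 1 - 3 * a) * s ∧ y = 3 * b + 1 ∧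
    z = 2 * k + 2) ∨
  (∃ s, 0 ≤ s ∧ s ≤ 1 ∧ t = s + 3 ∧ x = 3 * a' + 2 ∧ y = 3 * b + 1 ∧ z = 2 * k + 2 + s) ∨
  (∃ s, 0 ≤ s ∧ s ≤ 1 ∧ t = s + 4 ∧ x = 3 * a' + 2 ∧ y = 3 * b + 1 + (3 * b' - 3 * b - 1) * s ∧
    z = 2 * k + 3) ∨
  (∃ s, 0 ≤ s ∧ s ≤ 1 ∧ t = s + 5 ∧ x = 3 * a' + 2 - s ∧ y = 3 * b' ∧ z = 2 * k + 3) ∨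
  (∃ s, 0 ≤ s ∧ s ≤ 1 ∧ t = s + 6 ∧ x = 3 * a' + 1 - s ∧ y = 3 * b' ∧ z = (2 * k + 3) * (1 - s))

lemma pcs_of (a b a' b' k : ℤ) (t : ℝ) (ht : 0 ≤ t) (ht' : t ≤ 7) :
    Pcs a b a' b' k t (pX a a' t) (pY b b' t) (pZ k t) := by
  unfold Pcs pX pY pZ
  rcases le_total t 1 with h1 | h1
  · left
    refine ⟨t, by linarith, by linarith, by ring, ?_⟩
    rw [clp_mid (s := t) (by linarith) (by linarith), clp_zero (s := t - 1) (by linarith),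
      clp_zero (s := t - 2) (by linarith), clp_zero (s := t - 3) (by linarith),
      clp_zero (s := t - 4) (by linarith), clp_zero (s := t - 5) (by linarith),
      clp_zero (s := t - 6) (by linarith)]
    refine ⟨?_, ?_, ?_⟩ <;> ring
  right
  rcases le_total t 2 with h2 | h2
  · left
    refine ⟨t - 1, by linarith, by linarith, by ring, ?_⟩
    rw [clp_one (s := t) (by linarith), clp_mid (s := t - 1) (by linarith) (by linarith),
      clp_zero (s := t - 2) (by linarith), clp_zero (s := t - 3) (by linarith),
      clp_zero (s := t - 4) (by linarith), clp_zero (s := t - 5) (by linarith),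
      clp_zero (s := t - 6) (by linarith)]
    refine ⟨?_, ?_, ?_⟩ <;> ring
  right
  rcases le_total t 3 with h3 | h3
  · left
    refine ⟨t - 2, by linarith, by linarith, by ring, ?_⟩
    rw [clp_one (s := t) (by linarith), clp_one (s := t - 1) (by linarith),
      clp_mid (s := t - 2) (by linarith) (by linarith), clp_zero (s := t - 3) (by linarith),
      clp_zero (s := t - 4) (by linarith), clp_zero (s := t - 5) (by linarith),
      clp_zero (s := t - 6) (by linarith)]
    refine ⟨?_, ?_, ?_⟩ <;> ring
  right
  rcases le_total t 4 with h4 | h4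
  · left
    refine ⟨t - 3, by linarith, by linarith, by ring, ?_⟩
    rw [clp_one (s := t) (by linarith), clp_one (s := t - 1) (by linarith),
      clp_one (s := t - 2) (by linarith), clp_mid (s := t - 3) (by linarith) (by linarith),
      clp_zero (s := t - 4) (by linarith), clp_zero (s := t - 5) (by linarith),
      clp_zero (s := t - 6) (by linarith)]
    refine ⟨?_, ?_, ?_⟩ <;> ring
  right
  rcases le_total t 5 with h5 | h5
  · left
    refine ⟨t - 4, by linarith, by linarith, by ring, ?_⟩
    rw [clp_one (s := t) (by linarith), clp_one (s := t - 1) (by linarith),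
      clp_one (s := t - 2) (by linarith), clp_one (s := t - 3) (by linarith),
      clp_mid (s := t - 4) (by linarith) (by linarith), clp_zero (s := t - 5) (by linarith),
      clp_zero (s := t - 6) (by linarith)]
    refine ⟨?_, ?_, ?_⟩ <;> ring
  right
  rcases le_total t 6 with h6 | h6
  · left
    refine ⟨t - 5, by linarith, by linarith, by ring, ?_⟩
    rw [clp_one (s := t) (by linarith), clp_one (s := t - 1) (by linarith),
      clp_one (s := t - 2) (by linarith), clp_one (s := t - 3) (by linarith),
      clp_one (s := t - 4) (by linarith), clp_mid (s := t - 5) (by linarith) (by linarith),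
      clp_zero (s := t - 6) (by linarith)]
    refine ⟨?_, ?_, ?_⟩ <;> ring
  right
  refine ⟨t - 6, by linarith, by linarith, by ring, ?_⟩
  rw [clp_one (s := t) (by linarith), clp_one (s := t - 1) (by linarith),
    clp_one (s := t - 2) (by linarith), clp_one (s := t - 3) (by linarith),
    clp_one (s := t - 4) (by linarith), clp_one (s := t - 5) (by linarith),
    clp_mid (s := t - 6) (by linarith) (by linarith)]
  refine ⟨?_, ?_, ?_⟩ <;> ring

lemma int_tri (a a' : ℤ) : ((a : ℝ) + 1 ≤ a') ∨ a = a' ∨ ((a' : ℝ) + 1 ≤ a) := by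
  rcases lt_trichotomy a a' with h | h | h
  · left; exact_mod_cast h
  · right; left; exact h
  · right; right; exact_mod_cast h

lemma pcs_inj_le (a b a' b' k : ℤ) (hne : ¬ (a = a' ∧ b = b')) (hk : 0 ≤ k) (t t' x y z : ℝ)
    (hle : t < t')
    (h : Pcs a b a' b' k t x y z) (h' : Pcs a b a' b' k t' x y z) : False := by
  have hk' : (0:ℝ) ≤ k := by exact_mod_cast hk
  unfold Pcs at h h'
  rcases h with ⟨s, h0, h1, rfl, rfl, rfl, rfl⟩ | ⟨s, h0, h1, rfl, rfl, rfl, rfl⟩ |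
    ⟨s, h0, h1, rfl, rfl, rfl, rfl⟩ | ⟨s, h0, h1, rfl, rfl, rfl, rfl⟩ |
    ⟨s, h0, h1, rfl, rfl, rfl, rfl⟩ | ⟨s, h0, h1, rfl, rfl, rfl, rfl⟩ |
    ⟨s, h0, h1, rfl, rfl, rfl, rfl⟩ <;>
  rcases h' with ⟨r, g0, g1, rfl, ex, ey, ez⟩ | ⟨r, g0, g1, rfl, ex, ey, ez⟩ |
    ⟨r, g0, g1, rfl, ex, ey, ez⟩ | ⟨r, g0, g1, rfl, ex, ey, ez⟩ |
    ⟨r, g0, g1, rfl, ex, ey, ez⟩ | ⟨r, g0, g1, rfl, ex, ey, ez⟩ |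
    ⟨r, g0, g1, rfl, ex, ey, ez⟩ <;>
  first
  | linarith
  | (rcases int_tri a a' with ha | ha | ha <;> rcases int_tri b b' with hb | hb | hb <;>
      first
      | exact hne ⟨ha, hb⟩
      | linarith
      | (subst ha; linarith)
      | (subst hb; linarith)
      | nlinarith)

lemma pcs_inj (a b a' b' k : ℤ) (hne : ¬ (a = a' ∧ b = b')) (hk : 0 ≤ k) (t t' x y z : ℝ)
    (h : Pcs a b a' b' k t x y z) (h' : Pcs a b a' b' k t' x y z) : t = t' := by
  rcases lt_trichotomy t t' with g | g | g
  · exact (pcs_inj_le a b a' b' k hne hk t t' x y z g h h').elim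
  · exact g
  · exact (pcs_inj_le a b a' b' k hne hk t' t x y z g h' h).elim

/-- Tower over a vertex, with top height `h`. -/
def Tw (a b h : ℤ) (x y z : ℝ) : Prop :=
  3 * (a:ℝ) ≤ x ∧ x ≤ 3 * a + 1 ∧ y = 3 * b ∧ z = (x - 3 * a) * h

/-- Routing part. -/
def Rt (a b a' b' k : ℤ) (x y z : ℝ) : Prop :=
  (x = 3 * a + 1 ∧ 3 * b ≤ y ∧ y ≤ 3 * b + 1 ∧ z = 2 * k + 2) ∨
  (y = 3 * b + 1 ∧ z = 2 * k + 2) ∨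
  (x = 3 * a' + 2 ∧ y = 3 * b + 1 ∧ 2 * k + 2 ≤ z ∧ z ≤ 2 * k + 3) ∨
  (x = 3 * a' + 2 ∧ z = 2 * k + 3) ∨
  (3 * a' + 1 ≤ x ∧ x ≤ 3 * a' + 2 ∧ y = 3 * b' ∧ z = 2 * k + 3)

lemma pcs_reg (a b a' b' k : ℤ) (t x y z : ℝ) (h : Pcs a b a' b' k t x y z) :
    Tw a b (2 * k + 2) x y z ∨ Tw a' b' (2 * k + 3) x y z ∨ Rt a b a' b' k x y z := by
  unfold Pcs at h
  unfold Tw Rt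
  push_cast
  rcases h with ⟨s, h0, h1, rfl, rfl, rfl, rfl⟩ | ⟨s, h0, h1, rfl, rfl, rfl, rfl⟩ |
    ⟨s, h0, h1, rfl, rfl, rfl, rfl⟩ | ⟨s, h0, h1, rfl, rfl, rfl, rfl⟩ |
    ⟨s, h0, h1, rfl, rfl, rfl, rfl⟩ | ⟨s, h0, h1, rfl, rfl, rfl, rfl⟩ |
    ⟨s, h0, h1, rfl, rfl, rfl, rfl⟩
  · left; refine ⟨by linarith, by linarith, rfl, by ring⟩
  · right; right; left; refine ⟨rfl, by linarith, by linarith, rfl⟩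
  · right; right; right; left; exact ⟨rfl, rfl⟩
  · right; right; right; right; left; exact ⟨rfl, rfl, by linarith, by linarith⟩
  · right; right; right; right; right; left; exact ⟨rfl, rfl⟩
  · right; right; right; right; right; right; exact ⟨by linarith, by linarith, rfl, rfl⟩
  · right; left; refine ⟨by linarith, by linarith, rfl, by ring⟩

lemma pcs_bd (a b a' b' k n D : ℤ) (t x y z : ℝ) (h : Pcs a b a' b' k t x y z)
    (ha : 0 ≤ a) (hb : 0 ≤ b) (ha' : 0 ≤ a') (hb' : 0 ≤ b') (hk : 0 ≤ k)
    (han : a < n) (hbn : b < n) (han' : a' < n) (hbn' : b' < n) (hkD : k ≤ D) :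
    |x| ≤ 3 * n ∧ |y| ≤ 3 * n ∧ |z| ≤ 2 * D + 3 := by
  have ha : (0:ℝ) ≤ a := by exact_mod_cast ha
  have hb : (0:ℝ) ≤ b := by exact_mod_cast hb
  have ha' : (0:ℝ) ≤ a' := by exact_mod_cast ha'
  have hb' : (0:ℝ) ≤ b' := by exact_mod_cast hb'
  have hk : (0:ℝ) ≤ k := by exact_mod_cast hk
  have hkD : (k:ℝ) ≤ D := by exact_mod_cast hkD
  have han : (a:ℝ) + 1 ≤ n := by exact_mod_cast han
  have hbn : (b:ℝ) + 1 ≤ n := by exact_mod_cast hbn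
  have han' : (a':ℝ) + 1 ≤ n := by exact_mod_cast han'
  have hbn' : (b':ℝ) + 1 ≤ n := by exact_mod_cast hbn'
  rw [abs_le, abs_le, abs_le]
  unfold Pcs at h
  rcases h with ⟨s, h0, h1, rfl, rfl, rfl, rfl⟩ | ⟨s, h0, h1, rfl, rfl, rfl, rfl⟩ |
    ⟨s, h0, h1, rfl, rfl, rfl, rfl⟩ | ⟨s, h0, h1, rfl, rfl, rfl, rfl⟩ |
    ⟨s, h0, h1, rfl, rfl, rfl, rfl⟩ | ⟨s, h0, h1, rfl, rfl, rfl, rfl⟩ |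
    ⟨s, h0, h1, rfl, rfl, rfl, rfl⟩ <;>
  refine ⟨⟨?_, ?_⟩, ⟨?_, ?_⟩, ⟨?_, ?_⟩⟩ <;> first | linarith | nlinarith

lemma int_eq_of {a a' : ℤ} (h : (a:ℝ) < a' + 1) (h' : (a':ℝ) < a + 1) : a = a' := by
  have h1 : a < a' + 1 := by exact_mod_cast h
  have h2 : a' < a + 1 := by exact_mod_cast h'
  omega

def Cl (x y z x' y' z' : ℝ) : Prop := |x - x'| < 1 ∧ |y - y'| < 1 ∧ |z - z'| < 1

lemma tw_tw {a b h a' b' h' : ℤ} {x y z x' y' z' : ℝ} (H : Tw a b h x y z)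
    (H' : Tw a' b' h' x' y' z') (hc : Cl x y z x' y' z') : a = a' ∧ b = b' := by
  obtain ⟨h1, h2, h3, h4⟩ := H
  obtain ⟨g1, g2, g3, g4⟩ := H'
  obtain ⟨c1, c2, -⟩ := hc
  rw [abs_lt] at c1 c2
  constructor <;> apply int_eq_of <;> linarith

lemma tw_rt {a b h a1 b1 a2 b2 k : ℤ} {x y z x' y' z' : ℝ} (H : Tw a b h x y z)
    (H' : Rt a1 b1 a2 b2 k x' y' z') (hc : Cl x y z x' y' z') :
    (a = a1 ∧ b = b1 ∧ x' = 3 * a + 1 ∧ z' = 2 * k + 2) ∨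
      (a = a2 ∧ b = b2 ∧ 3 * a + 1 ≤ x' ∧ z' = 2 * k + 3) := by
  obtain ⟨h1, h2, h3, h4⟩ := H
  obtain ⟨c1, c2, -⟩ := hc
  rw [abs_lt] at c1 c2
  have key : ∀ m : ℤ, (3 * (m:ℝ) = 3 * b + 1 ∨ False) → False := by
    rintro m (hm | hm)
    · have : (3 * m : ℤ) = 3 * b + 1 := by exact_mod_cast hm
      omega
    · exact hm
  rcases H' with ⟨g1, g2, g3, g4⟩ | ⟨g1, g2⟩ | ⟨g1, g2, g3, g4⟩ | ⟨g1, g2⟩ | ⟨g1, g2, g3, g4⟩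
  · left
    have e1 : a = a1 := by apply int_eq_of <;> linarith
    have e2 : b = b1 := by apply int_eq_of <;> linarith
    subst e1 e2
    exact ⟨rfl, rfl, g1, g4⟩
  · exfalso
    rcases int_tri b b1 with e | e | e
    · linarith
    · subst e; linarith
    · linarith
  · exfalso
    rcases int_tri b b1 with e | e | e
    · linarith
    · subst e; linarith
    · linarith
  · exfalso
    rcases int_tri a a2 with e | e | e
    · linarith
    · subst e; linarith
    · linarith
  · right
    have e1 : a = a2 := by apply int_eq_of <;> linarith
    have e2 : b = b2 := by apply int_eq_of <;> linarith
    subst e1 e2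
    exact ⟨rfl, rfl, g1, g4⟩

lemma rt_rt {a b a' b' k a1 b1 a2 b2 l : ℤ} {x y z x' y' z' : ℝ} (H : Rt a b a' b' k x y z)
    (H' : Rt a1 b1 a2 b2 l x' y' z') (hc : Cl x y z x' y' z') :
    k = l ∧ (b = b1 ∨ a' = a2) := by
  obtain ⟨c1, c2, c3⟩ := hc
  rw [abs_lt] at c1 c2 c3
  unfold Rt at H H'
  rcases H with ⟨g1, g2, g3, g4⟩ | ⟨g1, g2⟩ | ⟨g1, g2, g3, g4⟩ | ⟨g1, g2⟩ | ⟨g1, g2, g3, g4⟩ <;>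
  rcases H' with ⟨f1, f2, f3, f4⟩ | ⟨f1, f2⟩ | ⟨f1, f2, f3, f4⟩ | ⟨f1, f2⟩ | ⟨f1, f2, f3, f4⟩ <;>
  (have e : k = l := by apply int_eq_of <;> linarith) <;>
  subst e <;>
  refine ⟨rfl, ?_⟩ <;>
  first
  | (exfalso; linarith)
  | (left; apply int_eq_of <;> linarith)
  | (right; apply int_eq_of <;> linarith)

/-- distinct levels, same point: the point is a vertex -/
lemma reg_meet {a b a' b' k a1 b1 a2 b2 l : ℤ} {x y z : ℝ} (hkl : k ≠ l)
    (H : Tw a b (2 * k + 2) x y z ∨ Tw a' b' (2 * k + 3) x y z ∨ Rt a b a' b' k x y z)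
    (H' : Tw a1 b1 (2 * l + 2) x y z ∨ Tw a2 b2 (2 * l + 3) x y z ∨ Rt a1 b1 a2 b2 l x y z) :
    (x = 3 * a ∧ y = 3 * b ∧ z = 0) ∨ (x = 3 * a' ∧ y = 3 * b' ∧ z = 0) := by
  have hc : Cl x y z x y z := by simp [Cl]
  have tt : ∀ {a b h a' b' h' : ℤ}, Tw a b h x y z → Tw a' b' h' x y z → h ≠ h' →
      x = 3 * a ∧ y = 3 * b ∧ z = 0 := by
    intro a b h a' b' h' T T' hh
    obtain ⟨rfl, rfl⟩ := tw_tw T T' hc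
    obtain ⟨h1, h2, h3, h4⟩ := T
    obtain ⟨g1, g2, g3, g4⟩ := T'
    have e : (x - 3 * a) * ((h:ℝ) - h') = 0 := by linarith
    have hh' : (h:ℝ) - h' ≠ 0 := by
      intro e; apply hh; exact_mod_cast sub_eq_zero.mp e
    have e2 : x - 3 * a = 0 := (mul_eq_zero.mp e).resolve_right hh'
    refine ⟨by linarith, h3, by rw [h4, e2]; ring⟩
  have tr : ∀ {a b h a1 b1 a2 b2 k : ℤ}, Tw a b h x y z → Rt a1 b1 a2 b2 k x y z →
      h ≠ 2 * k + 2 → h ≠ 2 * k + 3 → False := by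
    intro a b h a1 b1 a2 b2 k T T' hh hh'
    obtain ⟨h1, h2, h3, h4⟩ := id T
    rcases tw_rt T T' hc with ⟨-, -, e1, e2⟩ | ⟨-, -, e1, e2⟩
    · rw [e1, e2] at h4
      apply hh
      have : (h:ℝ) = 2 * k + 2 := by linarith
      exact_mod_cast this
    · have e3 : x = 3 * a + 1 := by linarith
      rw [e3, e2] at h4
      apply hh'
      have : (h:ℝ) = 2 * k + 3 := by linarith
      exact_mod_cast this
  rcases H with H | H | H <;> rcases H' with H' | H' | H'
  · left; exact tt H H' (by omega)
  · left; exact tt H H' (by omega)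
  · exact (tr H H' (by omega) (by omega)).elim
  · right; exact tt H H' (by omega)
  · right; exact tt H H' (by omega)
  · exact (tr H H' (by omega) (by omega)).elim
  · exact (tr H' H (by omega) (by omega)).elim
  · exact (tr H' H (by omega) (by omega)).elim
  · exact (hkl (rt_rt H H' hc).1).elim

lemma cl_symm {x y z x' y' z' : ℝ} (h : Cl x y z x' y' z') : Cl x' y' z' x y z := by
  obtain ⟨h1, h2, h3⟩ := h
  exact ⟨by rwa [abs_sub_comm], by rwa [abs_sub_comm], by rwa [abs_sub_comm]⟩

/-- vertex-disjoint edges are not close, given the level condition -/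
lemma reg_far {a b a' b' k a1 b1 a2 b2 l : ℤ} {x y z x' y' z' : ℝ}
    (H : Tw a b (2 * k + 2) x y z ∨ Tw a' b' (2 * k + 3) x y z ∨ Rt a b a' b' k x y z)
    (H' : Tw a1 b1 (2 * l + 2) x' y' z' ∨ Tw a2 b2 (2 * l + 3) x' y' z' ∨
      Rt a1 b1 a2 b2 l x' y' z')
    (n1 : ¬ (a = a1 ∧ b = b1)) (n2 : ¬ (a = a2 ∧ b = b2)) (n3 : ¬ (a' = a1 ∧ b' = b1))
    (n4 : ¬ (a' = a2 ∧ b' = b2)) (hl : k = l → b ≠ b1 ∧ a' ≠ a2) (hc : Cl x y z x' y' z') :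
    False := by
  rcases H with H | H | H <;> rcases H' with H' | H' | H'
  · exact n1 (tw_tw H H' hc)
  · exact n2 (tw_tw H H' hc)
  · rcases tw_rt H H' hc with ⟨e1, e2, -⟩ | ⟨e1, e2, -⟩
    · exact n1 ⟨e1, e2⟩
    · exact n2 ⟨e1, e2⟩
  · exact n3 (tw_tw H H' hc)
  · exact n4 (tw_tw H H' hc)
  · rcases tw_rt H H' hc with ⟨e1, e2, -⟩ | ⟨e1, e2, -⟩
    · exact n3 ⟨e1, e2⟩
    · exact n4 ⟨e1, e2⟩
  · rcases tw_rt H' H (cl_symm hc) with ⟨e1, e2, -⟩ | ⟨e1, e2, -⟩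
    · exact n1 ⟨e1.symm, e2.symm⟩
    · exact n3 ⟨e1.symm, e2.symm⟩
  · rcases tw_rt H' H (cl_symm hc) with ⟨e1, e2, -⟩ | ⟨e1, e2, -⟩
    · exact n2 ⟨e1.symm, e2.symm⟩
    · exact n4 ⟨e1.symm, e2.symm⟩
  · obtain ⟨e, h⟩ := rt_rt H H' hc
    rcases h with h | h
    · exact (hl e).1 h
    · exact (hl e).2 h

/-- vertex far from an edge -/
lemma vert_far {a b h a1 b1 a2 b2 l : ℤ} {x y z x' y' z' : ℝ}
    (H : Tw a b h x y z)
    (H' : Tw a1 b1 (2 * l + 2) x' y' z' ∨ Tw a2 b2 (2 * l + 3) x' y' z' ∨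
      Rt a1 b1 a2 b2 l x' y' z')
    (n1 : ¬ (a = a1 ∧ b = b1)) (n2 : ¬ (a = a2 ∧ b = b2)) (hc : Cl x y z x' y' z') :
    False := by
  rcases H' with H' | H' | H'
  · exact n1 (tw_tw H H' hc)
  · exact n2 (tw_tw H H' hc)
  · rcases tw_rt H H' hc with ⟨e1, e2, -⟩ | ⟨e1, e2, -⟩
    · exact n1 ⟨e1, e2⟩
    · exact n2 ⟨e1, e2⟩

lemma dist_of_not_cl (p q : EuclideanSpace ℝ (Fin 3))
    (h : Cl (p 0) (p 1) (p 2) (q 0) (q 1) (q 2) → False) : 1 ≤ dist p q := by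
  by_contra hlt
  push Not at hlt
  have key : ∀ i, |p i - q i| < 1 := by
    intro i
    have := PiLp.norm_apply_le (p - q) i
    rw [← dist_eq_norm] at this
    exact lt_of_le_of_lt this hlt
  exact h ⟨key 0, key 1, key 2⟩

lemma norm_le_of_coord (p : EuclideanSpace ℝ (Fin 3)) (r s t : ℝ)
    (h0 : |p 0| ≤ r) (h1 : |p 1| ≤ s) (h2 : |p 2| ≤ t) : ‖p‖ ≤ r + s + t := by
  rw [EuclideanSpace.norm_eq, Fin.sum_univ_three]
  have a0 := abs_nonneg (p 0)
  have a1 := abs_nonneg (p 1)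
  have a2 := abs_nonneg (p 2)
  apply Real.sqrt_le_iff.mpr
  refine ⟨by linarith, ?_⟩
  simp only [Real.norm_eq_abs]
  nlinarith [mul_nonneg a0 a1, mul_nonneg a0 a2, mul_nonneg a1 a2,
    mul_self_le_mul_self (add_nonneg (add_nonneg a0 a1) a2) (add_le_add (add_le_add h0 h1) h2)]

lemma count_conf {V : Type} [Fintype V] (G : SimpleGraph V) [DecidableRel G.Adj] (d n : ℕ)
    (hdeg : ∀ v : V, G.degree v ≤ d) (ra rb : V → ℕ) (hra : ∀ v, ra v < n) (hrb : ∀ v, rb v < n)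
    (hinj : ∀ u v, ra u = ra v → rb u = rb v → u = v) (q : V × V) :
    (Finset.univ.filter (fun q' : V × V => G.Adj q'.1 q'.2 ∧
      ∃ x, (x = q.1 ∨ x = q.2) ∧ ∃ y, (y = q'.1 ∨ y = q'.2) ∧ (ra x = ra y ∨ rb x = rb y))).card
      ≤ 8 * n * d := by
  have cA : ∀ c, (Finset.univ.filter (fun y => ra y = c)).card ≤ n := by
    intro c
    rw [← Finset.card_range n]
    apply Finset.card_le_card_of_injOn rb
    · intro y _; simpa using hrb y
    · intro y hy y' hy' h
      simp at hy hy'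
      exact hinj _ _ (hy.trans hy'.symm) h
  have cB : ∀ c, (Finset.univ.filter (fun y => rb y = c)).card ≤ n := by
    intro c
    rw [← Finset.card_range n]
    apply Finset.card_le_card_of_injOn ra
    · intro y _; simpa using hra y
    · intro y hy y' hy' h
      simp at hy hy'
      exact hinj _ _ h (hy.trans hy'.symm)
  let Y : Finset V := ((Finset.univ.filter (fun y => ra y = ra q.1)) ∪
    (Finset.univ.filter (fun y => rb y = rb q.1))) ∪
    ((Finset.univ.filter (fun y => ra y = ra q.2)) ∪ (Finset.univ.filter (fun y => rb y = rb q.2)))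
  have hY : Y.card ≤ 4 * n := by
    have h1 := cA (ra q.1)
    have h2 := cB (rb q.1)
    have h3 := cA (ra q.2)
    have h4 := cB (rb q.2)
    refine (Finset.card_union_le _ _).trans ?_
    have := Finset.card_union_le (Finset.univ.filter (fun y => ra y = ra q.1))
      (Finset.univ.filter (fun y => rb y = rb q.1))
    have := Finset.card_union_le (Finset.univ.filter (fun y => ra y = ra q.2))
      (Finset.univ.filter (fun y => rb y = rb q.2))
    omega
  let S : V → Finset (V × V) := fun y =>
    (G.neighborFinset y).image (fun z => (y, z)) ∪ (G.neighborFinset y).image (fun z => (z, y))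
  have hS : ∀ y ∈ Y, (S y).card ≤ 2 * d := by
    intro y _
    have h0 := hdeg y
    rw [← SimpleGraph.card_neighborFinset_eq_degree] at h0
    refine (Finset.card_union_le _ _).trans ?_
    have h1 := Finset.card_image_le (s := G.neighborFinset y) (f := fun z => (y, z))
    have h2 := Finset.card_image_le (s := G.neighborFinset y) (f := fun z => (z, y))
    omega
  calc _ ≤ (Y.biUnion S).card := by
        apply Finset.card_le_card
        rintro ⟨u, v⟩ hq
        simp only [Finset.mem_filter, Finset.mem_univ, true_and] at hq
        obtain ⟨hadj, x, hx, y, hy, hxy⟩ := hq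
        rw [Finset.mem_biUnion]
        refine ⟨y, ?_, ?_⟩
        · simp only [Y, Finset.mem_union, Finset.mem_filter, Finset.mem_univ, true_and]
          rcases hx with rfl | rfl <;> rcases hxy with h | h <;> simp [h]
        · simp only [S, Finset.mem_union, Finset.mem_image, SimpleGraph.mem_neighborFinset]
          rcases hy with rfl | rfl
          · left; exact ⟨v, hadj, rfl⟩
          · right; exact ⟨u, hadj.symm, rfl⟩
    _ ≤ Y.card * (2 * d) := Finset.card_biUnion_le_card_mul _ _ _ hS
    _ ≤ (4 * n) * (2 * d) := Nat.mul_le_mul_right _ hY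
    _ = 8 * n * d := by ring

lemma pX_zero (a a' : ℤ) : pX a a' 0 = 3 * a := by
  unfold pX; simp [clp]
lemma pX_seven (a a' : ℤ) : pX a a' 7 = 3 * a' := by
  unfold pX
  rw [clp_one (by norm_num), clp_one (by norm_num), clp_one (by norm_num), clp_one (by norm_num)]
  ring
lemma pY_zero (a a' : ℤ) : pY a a' 0 = 3 * a := by
  unfold pY; simp [clp]
lemma pY_seven (a a' : ℤ) : pY a a' 7 = 3 * a' := by
  unfold pY
  rw [clp_one (by norm_num), clp_one (by norm_num)]
  ring
lemma pZ_zero (k : ℤ) : pZ k 0 = 0 := by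
  unfold pZ; simp [clp]
lemma pZ_seven (k : ℤ) : pZ k 7 = 0 := by
  unfold pZ
  rw [clp_one (by norm_num), clp_one (by norm_num), clp_one (by norm_num)]
  ring

theorem statement0 (d : ℕ) (hd : 1 ≤ d) :
    ∃ C : ℝ, 0 < C ∧
      ∀ (V : Type) [Fintype V] (G : SimpleGraph V) [DecidableRel G.Adj],
        1 ≤ Fintype.card V → (∀ v : V, G.degree v ≤ d) →
        ∀ (E : Type) [NormedAddCommGroup E] [NormedSpace ℝ E]
          (K : Geometry.SimplicialComplex ℝ E) (f : V → E),
          IsGraphRealization G K f →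
          ∃ I : K.space → EuclideanSpace ℝ (Fin 3),
            Continuous I ∧ Function.Injective I ∧
            (∀ x, I x ∈ Metric.closedBall (0 : EuclideanSpace ℝ (Fin 3))
              (C * (Fintype.card V : ℝ) ^ ((1 : ℝ) / 2))) ∧
            HasCombThickness K I 1 := by
  refine ⟨2 * (16 * d + 9), by positivity, ?_⟩
  intro V _ G _ hN hdeg E _ _ K f hK
  set N := Fintype.card V with hNdef
  set n := Nat.sqrt N + 1 with hn
  have hnpos : 0 < n := Nat.succ_pos _
  let e : V ≃ Fin N := Fintype.equivFin V
  let ra : V → ℕ := fun v => (e v : ℕ) % n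
  let rb : V → ℕ := fun v => (e v : ℕ) / n
  have hra : ∀ v, ra v < n := fun v => Nat.mod_lt _ hnpos
  have hrb : ∀ v, rb v < n := by
    intro v
    apply Nat.div_lt_of_lt_mul
    exact (e v).2.trans (Nat.lt_succ_sqrt N)
  have hinj : ∀ u v, ra u = ra v → rb u = rb v → u = v := by
    intro u v h1 h2
    apply e.injective
    apply Fin.ext
    rw [← Nat.mod_add_div (e u : ℕ) n, ← Nat.mod_add_div (e v : ℕ) n]
    simp only [ra, rb] at h1 h2
    rw [h1, h2]
  let O : V → V → Prop := fun u v => G.Adj u v ∧ e u < e v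
  let r : V × V → V × V → Prop := fun q q' => G.Adj q.1 q.2 ∧ G.Adj q'.1 q'.2 ∧
      ∃ x, (x = q.1 ∨ x = q.2) ∧ ∃ y, (y = q'.1 ∨ y = q'.2) ∧ (ra x = ra y ∨ rb x = rb y)
  obtain ⟨k, hkD, hk⟩ := greedy_col r (8 * n * d) (by
      rintro q q' ⟨h1, h2, x, hx, y, hy, hxy⟩
      exact ⟨h2, h1, y, hy, x, hx, hxy.imp Eq.symm Eq.symm⟩) (by
      intro q
      refine le_trans (Finset.card_le_card ?_) (count_conf G d n hdeg ra rb hra hrb hinj q)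
      intro q' hq'
      simp only [Finset.mem_filter, Finset.mem_univ, true_and, r] at hq' ⊢
      exact hq'.2)
  let a : V → ℤ := fun v => ra v
  let b : V → ℤ := fun v => rb v
  let κ : V → V → ℤ := fun u v => k (u, v)
  have hab : ∀ u v, u ≠ v → ¬ (a u = a v ∧ b u = b v) := by
    rintro u v huv ⟨h1, h2⟩
    exact huv (hinj u v (Int.ofNat.inj h1) (Int.ofNat.inj h2))
  -- same level edges
  have hlev : ∀ u v u' v', O u v → O u' v' → ¬ (u = u' ∧ v = v') → κ u v = κ u' v' →
      ∀ x, (x = u ∨ x = v) → ∀ y, (y = u' ∨ y = v') → a x ≠ a y ∧ b x ≠ b y := by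
    intro u v u' v' h h' hne hκ x hx y hy
    have hκ' : k (u, v) = k (u', v') := Int.ofNat.inj hκ
    have hnr : ¬ r (u, v) (u', v') := by
      intro hr
      refine hk _ _ ?_ hr hκ'
      intro e; exact hne (Prod.mk.inj e)
    constructor
    · intro e
      exact hnr ⟨h.1, h'.1, x, hx, y, hy, Or.inl (Int.ofNat.inj e)⟩
    · intro e
      exact hnr ⟨h.1, h'.1, x, hx, y, hy, Or.inr (Int.ofNat.inj e)⟩
  let p : V → EuclideanSpace ℝ (Fin 3) := fun v => !₂[3 * (a v : ℝ), 3 * (b v : ℝ), 0]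
  let γ : V → V → ℝ → EuclideanSpace ℝ (Fin 3) := fun u v t =>
    !₂[pX (a u) (a v) (7 * t), pY (b u) (b v) (7 * t), pZ (κ u v) (7 * t)]
  have hpc : ∀ u v, ∀ t ∈ Set.Icc (0:ℝ) 1, Pcs (a u) (b u) (a v) (b v) (κ u v) (7 * t)
      (γ u v t 0) (γ u v t 1) (γ u v t 2) := by
    intro u v t ht
    exact pcs_of _ _ _ _ _ _ (by linarith [ht.1]) (by linarith [ht.2])
  have hreg := fun u v t ht => pcs_reg _ _ _ _ _ _ _ _ _ (hpc u v t ht)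
  have hptw : ∀ v, Tw (a v) (b v) 0 (p v 0) (p v 1) (p v 2) := by
    intro v
    simp [Tw, p]
  have h0 : ∀ u v, γ u v 0 = p u := by
    intro u v
    simp only [γ, p, mul_zero, pX_zero, pY_zero, pZ_zero]
  have h1 : ∀ u v, γ u v 1 = p v := by
    intro u v
    simp only [γ, p, mul_one, pX_seven, pY_seven, pZ_seven]
  have hγinj : ∀ u v, u ≠ v → ∀ s ∈ Set.Icc (0:ℝ) 1, ∀ t ∈ Set.Icc (0:ℝ) 1,
      γ u v s = γ u v t → s = t := by
    intro u v huv s hs t ht hst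
    have A := hpc u v s hs
    have B := hpc u v t ht
    rw [hst] at A
    have := pcs_inj _ _ _ _ _ (hab u v huv) (by simp [κ]) _ _ _ _ _ A B
    linarith
  have hOne : ∀ u v, O u v → u ≠ v := fun u v h => h.1.ne
  have t1 : ∀ u v, u ≠ v → 1 ≤ dist (p u) (p v) := by
    intro u v huv
    apply dist_of_not_cl
    intro hc
    exact hab u v huv (tw_tw (hptw u) (hptw v) hc)
  have t2 : ∀ u v, O u v → ∀ w, w ≠ u → w ≠ v → ∀ t ∈ Set.Icc (0:ℝ) 1,
      1 ≤ dist (p w) (γ u v t) := by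
    intro u v h w hu hv t ht
    apply dist_of_not_cl
    exact vert_far (hptw w) (hreg u v t ht) (hab _ _ hu) (hab _ _ hv)
  have t3 : ∀ u v, O u v → ∀ u' v', O u' v' → u ≠ u' → u ≠ v' → v ≠ u' → v ≠ v' →
      ∀ s ∈ Set.Icc (0:ℝ) 1, ∀ t ∈ Set.Icc (0:ℝ) 1, 1 ≤ dist (γ u v s) (γ u' v' t) := by
    intro u v h u' v' h' n1 n2 n3 n4 s hs t ht
    apply dist_of_not_cl
    refine reg_far (hreg u v s hs) (hreg u' v' t ht) (hab _ _ n1) (hab _ _ n2) (hab _ _ n3)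
      (hab _ _ n4) ?_
    intro hκ
    have := hlev u v u' v' h h' (fun h => n1 h.1) hκ
    exact ⟨(this u (Or.inl rfl) u' (Or.inl rfl)).2, (this v (Or.inr rfl) v' (Or.inr rfl)).1⟩
  have h2 : ∀ u v, O u v → ∀ t ∈ Set.Ioo (0:ℝ) 1, ∀ w, γ u v t ≠ p w := by
    intro u v h t ht w he
    have ht' : t ∈ Set.Icc (0:ℝ) 1 := ⟨ht.1.le, ht.2.le⟩
    by_cases hu : w = u
    · subst hu
      rw [← h0 w v] at he
      have := hγinj w v (hOne _ _ h) t ht' 0 (by simp) he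
      exact ht.1.ne' this
    by_cases hv : w = v
    · subst hv
      rw [← h1 u w] at he
      have := hγinj u w (hOne _ _ h) t ht' 1 (by simp) he
      exact ht.2.ne this
    have := t2 u v h w hu hv t ht'
    rw [he, dist_self] at this
    linarith
  have hRn : (3 * (n:ℝ) + 3 * n + (2 * ((8 * n * d : ℕ) : ℝ) + 3)) ≤
      2 * (16 * d + 9) * (N : ℝ) ^ ((1 : ℝ) / 2) := by
    rw [← Real.sqrt_eq_rpow]
    have hs1 : (1:ℝ) ≤ Real.sqrt N := by
      rw [Real.one_le_sqrt]; exact_mod_cast hN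
    have hs2 : (Nat.sqrt N : ℝ) ≤ Real.sqrt N := Real.nat_sqrt_le_real_sqrt
    have hn2 : (n:ℝ) ≤ 2 * Real.sqrt N := by
      rw [hn]; push_cast; linarith
    have hn1 : (1:ℝ) ≤ n := by exact_mod_cast hnpos
    have hd0 : (0:ℝ) ≤ d := by positivity
    push_cast
    calc _ ≤ (16 * (d:ℝ) + 9) * n := by nlinarith
      _ ≤ (16 * (d:ℝ) + 9) * (2 * Real.sqrt N) := by gcongr
      _ = _ := by ring
  have hb : ∀ u v, ∀ t ∈ Set.Icc (0:ℝ) 1, ‖γ u v t‖ ≤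
      2 * (16 * d + 9) * (N : ℝ) ^ ((1 : ℝ) / 2) := by
    intro u v t ht
    refine le_trans ?_ hRn
    obtain ⟨A, B, C⟩ := pcs_bd _ _ _ _ _ (n : ℤ) ((8 * n * d : ℕ) : ℤ) _ _ _ _ (hpc u v t ht)
      (by simp [a]) (by simp [b]) (by simp [a]) (by simp [b]) (by simp [κ])
      (by simpa [a] using hra u) (by simpa [b] using hrb u)
      (by simpa [a] using hra v) (by simpa [b] using hrb v)
      (Int.ofNat_le.mpr (hkD (u, v)))
    exact norm_le_of_coord _ _ _ _ (by exact_mod_cast A) (by exact_mod_cast B)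
      (by exact_mod_cast C)
  refine glue_emb G K f hK O (fun u v h => h.1) ?_ ?_ p γ ?_ h0 h1 ?_ h2 ?_ _
    (fun u v _ => hb u v) ?_ t1 t2 t3
  · intro u v h
    rcases lt_trichotomy (e u) (e v) with g | g | g
    · exact Or.inl ⟨h, g⟩
    · exact absurd (e.injective g) h.ne
    · exact Or.inr ⟨h.symm, g⟩
  · intro u v h h'
    exact lt_asymm h.2 h'.2
  · intro u v
    have c1 := clp_cont
    simp only [γ, pX, pY, pZ]
    refine (PiLp.continuous_toLp 2 _).comp ?_
    refine continuous_pi ?_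
    intro i
    fin_cases i <;> simp <;> fun_prop
  · intro u v huv
    by_contra hne
    have := t1 u v hne
    rw [huv, dist_self] at this
    linarith
  · intro u v h u' v' h' s hs t ht hst
    have hs' : s ∈ Set.Icc (0:ℝ) 1 := ⟨hs.1.le, hs.2.le⟩
    have ht' : t ∈ Set.Icc (0:ℝ) 1 := ⟨ht.1.le, ht.2.le⟩
    by_cases hee : u = u' ∧ v = v'
    · obtain ⟨rfl, rfl⟩ := hee
      exact ⟨rfl, rfl, hγinj u v (hOne _ _ h) s hs' t ht' hst⟩
    exfalso
    by_cases hκ : κ u v = κ u' v'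
    · have hl := hlev u v u' v' h h' hee hκ
      have := t3 u v h u' v' h'
        (by intro e; exact (hl u (Or.inl rfl) u' (Or.inl rfl)).1 (by rw [e]))
        (by intro e; exact (hl u (Or.inl rfl) v' (Or.inr rfl)).1 (by rw [e]))
        (by intro e; exact (hl v (Or.inr rfl) u' (Or.inl rfl)).1 (by rw [e]))
        (by intro e; exact (hl v (Or.inr rfl) v' (Or.inr rfl)).1 (by rw [e])) s hs' t ht'
      rw [hst, dist_self] at this
      linarith
    · have A := hreg u v s hs'
      have B := hreg u' v' t ht'
      rw [← hst] at B
      have hpt : ∀ w, γ u v s 0 = 3 * (a w : ℝ) ∧ γ u v s 1 = 3 * (b w : ℝ) ∧ γ u v s 2 = 0 →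
          False := by
        rintro w ⟨e1, e2, e3⟩
        apply h2 u v h s hs w
        ext i
        fin_cases i
        · simpa [p] using e1
        · simpa [p] using e2
        · simpa [p] using e3
      rcases reg_meet hκ A B with e | e
      · exact hpt u e
      · exact hpt v e
  · intro v
    rw [← h0 v v]
    exact hb v v 0 (by simp)
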